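/- arXiv:1811.04701 — 2 statements merged into one kernel-verified Lean document; each statement's English description precedes it below -/
import Mathlib

section
/- Let q be an odd prime power and let H^d be the orthogonal direct sum of d hyperbolic planes over F_q (a split quadratic space of dimension 2d) with a fixed maximal isotropic subspace I of dimension d. For 0 ≤ l ≤ k ≤ d, the number of k-dimensional isotropic subspaces V of H^d with dim(V/(V ∩ I)) = l equals q^{l(2d+l-2k-1)/2} · C(d,k)_q · C(k,l)_q. -/
/-- Gaussian (q-)binomial coefficient `C(d,k)_q`, defined by
`C(d,0)_q = 1`, `C(0,k+1)_q = 0` and `C(d,i)_q = C(d-1,i-1)_q + q^i C(d-1,i)_q`. -/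
def qBinom {R : Type*} [CommRing R] (q : R) : ℕ → ℕ → R
  | _, 0 => 1
  | 0, _ + 1 => 0
  | d + 1, k + 1 => qBinom q d k + q ^ (k + 1) * qBinom q d (k + 1)

/-- The fixed maximal isotropic subspace (metabolizer) `I` of `H^d`:
vectors whose second coordinates all vanish. -/
def metab (F : Type*) [Field F] (d : ℕ) : Submodule F (Fin d → F × F) where
  carrier := {x | ∀ i, (x i).2 = 0}
  add_mem' := by
    intro a b ha hb i
    simp [ha i, hb i]
  zero_mem' := by intro i; simp
  smul_mem' := by
    intro c x hx i
    simp [hx i]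

section GaussianBinomial

theorem qBinom_succ_succ {R : Type*} [CommRing R] (q : R) (n k : ℕ) :
    qBinom q (n + 1) (k + 1) = qBinom q n k + q ^ (k + 1) * qBinom q n (k + 1) :=
  rfl

theorem qBinom_of_lt {R : Type*} [CommRing R] (q : R) :
    ∀ {n k : ℕ}, n < k → qBinom q n k = 0
  | 0, _ + 1, _ => by simp [qBinom]
  | n + 1, k + 1, h => by
      simp [qBinom, qBinom_of_lt q (show n < k by omega), qBinom_of_lt q (show n < k + 1 by omega)]

/-- The unnormalised `q`-factorial `∏_{i=1}^{n} (q^i - 1)`. -/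
def qFact {R : Type*} [CommRing R] (q : R) (n : ℕ) : R :=
  ∏ i ∈ Finset.range n, (q ^ (i + 1) - 1)

theorem qFact_succ {R : Type*} [CommRing R] (q : R) (n : ℕ) :
    qFact q (n + 1) = qFact q n * (q ^ (n + 1) - 1) :=
  Finset.prod_range_succ _ _

theorem qBinom_self {R : Type*} [CommRing R] (q : R) : ∀ n, qBinom q n n = 1
  | 0 => by simp [qBinom]
  | n + 1 => by simp [qBinom, qBinom_self q n, qBinom_of_lt q (Nat.lt_succ_self n)]

theorem qBinom_mul_qFact {R : Type*} [CommRing R] (q : R) :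
    ∀ a b : ℕ, qBinom q (a + b) a * qFact q a * qFact q b = qFact q (a + b)
  | 0, b => by simp [qBinom, qFact]
  | a + 1, 0 => by simp [qBinom_self, qFact]
  | a + 1, b + 1 => by
      have h1 := qBinom_mul_qFact q a (b + 1)
      have h2 := qBinom_mul_qFact q (a + 1) b
      rw [show a + 1 + (b + 1) = (a + (b + 1)) + 1 by ring, qFact_succ q (a + (b + 1))]
      rw [show a + 1 + b = a + (b + 1) by ring] at h2
      rw [show a + (b + 1) + 1 = (a + (b + 1)) + 1 from rfl, qBinom_succ_succ]
      rw [qFact_succ q a] at h2 ⊢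
      rw [qFact_succ q b] at h1 ⊢
      linear_combination (q ^ (a + 1) - 1) * h1 + q ^ (a + 1) * (q ^ (b + 1) - 1) * h2

theorem prod_pow_sub_pow_mul_qFact {R : Type*} [CommRing R] (q : R) :
    ∀ k m : ℕ, (∏ i ∈ Finset.range k, (q ^ (k + m) - q ^ i)) * qFact q m =
      (∏ i ∈ Finset.range k, q ^ i) * qFact q (k + m)
  | 0, m => by simp
  | k + 1, m => by
      have h := prod_pow_sub_pow_mul_qFact q k (m + 1)
      rw [Finset.prod_range_succ, Finset.prod_range_succ, show k + 1 + m = k + (m + 1) by ring]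
      rw [qFact_succ q m] at h
      linear_combination q ^ k * h

theorem qFact_ne_zero {q : ℚ} (hq : 1 < q) (n : ℕ) : qFact q n ≠ 0 :=
  Finset.prod_ne_zero_iff.2 fun _ _ => sub_ne_zero.2 (one_lt_pow₀ hq (by omega)).ne'

theorem prod_pow_sub_pow_ne_zero {q : ℚ} (hq : 1 < q) {n k : ℕ} (h : k ≤ n) :
    ∏ i ∈ Finset.range k, (q ^ n - q ^ i) ≠ 0 :=
  Finset.prod_ne_zero_iff.2 fun _ hi => sub_ne_zero.2
    (pow_lt_pow_right₀ hq ((Finset.mem_range.1 hi).trans_le h)).ne'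

theorem qBinom_mul_prod {q : ℚ} (hq : 1 < q) {n k : ℕ} (h : k ≤ n) :
    qBinom q n k * ∏ i ∈ Finset.range k, (q ^ k - q ^ i) =
      ∏ i ∈ Finset.range k, (q ^ n - q ^ i) := by
  obtain ⟨m, rfl⟩ := Nat.exists_eq_add_of_le h
  have h1 := prod_pow_sub_pow_mul_qFact q k m
  have h2 := prod_pow_sub_pow_mul_qFact q k 0
  have h3 := qBinom_mul_qFact q k m
  simp only [add_zero] at h2
  have h0 : qFact q 0 = 1 := by simp [qFact]
  rw [h0, mul_one] at h2
  apply mul_right_cancel₀ (qFact_ne_zero hq m)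
  rw [h1, h2, ← h3]
  ring

theorem qBinom_trinomial {q : ℚ} (hq : 1 < q) {d k l : ℕ} (hl : l ≤ k) (hk : k ≤ d) :
    qBinom q d l * qBinom q (d - l) (k - l) = qBinom q d k * qBinom q k l := by
  obtain ⟨a, rfl⟩ := Nat.exists_eq_add_of_le hl
  obtain ⟨b, rfl⟩ := Nat.exists_eq_add_of_le hk
  have h1 := qBinom_mul_qFact q l (a + b)
  have h2 := qBinom_mul_qFact q a b
  have h3 := qBinom_mul_qFact q (l + a) b
  have h4 := qBinom_mul_qFact q l a
  rw [show l + a + b - l = a + b by omega, show l + a - l = a by omega]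
  rw [← add_assoc] at h1
  apply mul_right_cancel₀ (qFact_ne_zero hq l)
  apply mul_right_cancel₀ (qFact_ne_zero hq a)
  apply mul_right_cancel₀ (qFact_ne_zero hq b)
  calc _ = qBinom q (l + a + b) l * qFact q l *
        (qBinom q (a + b) a * qFact q a * qFact q b) := by ring
    _ = qBinom q (l + a + b) (l + a) * (qBinom q (l + a) l * qFact q l * qFact q a) *
        qFact q b := by rw [h2, h1, h4, h3]
    _ = _ := by ring

end GaussianBinomial

section Counting

theorem Nat.card_sigma_const {α : Type*} {β : α → Type*} [Finite α] [∀ a, Finite (β a)] (n : ℕ)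
    (h : ∀ a, Nat.card (β a) = n) : Nat.card (Σ a, β a) = Nat.card α * n := by
  have := Fintype.ofFinite α
  simp [Nat.card_sigma, h]

theorem Nat.card_mul_eq_card_mul_of_rel {α β : Type*} [Finite α] [Finite β] (r : α → β → Prop)
    (a b : ℕ) (ha : ∀ x, Nat.card {y // r x y} = a) (hb : ∀ y, Nat.card {x // r x y} = b) :
    Nat.card α * a = Nat.card β * b := by
  rw [← Nat.card_sigma_const a ha, ← Nat.card_sigma_const b hb]
  exact Nat.card_congr
    { toFun := fun p => ⟨p.2.1, p.1, p.2.2⟩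
      invFun := fun p => ⟨p.2.1, p.1, p.2.2⟩
      left_inv := fun _ => rfl
      right_inv := fun _ => rfl }

theorem LinearMap.natCard_preimage_of_surjective {K V V' : Type*} [Field K] [AddCommGroup V]
    [Module K V] [AddCommGroup V'] [Module K V'] (f : V →ₗ[K] V')
    (hf : Function.Surjective f) (p : V' → Prop) :
    Nat.card {v // p (f v)} = Nat.card (LinearMap.ker f) * Nat.card {v // p v} := by
  obtain ⟨g, hg⟩ := f.exists_rightInverse_of_surjective (LinearMap.range_eq_top.2 hf)
  have hg' : ∀ v, f (g v) = v := fun v => LinearMap.congr_fun hg v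
  rw [← Nat.card_prod]
  exact Nat.card_congr
    { toFun := fun v => (⟨v.1 - g (f v.1), by simp [hg']⟩, ⟨f v.1, v.2⟩)
      invFun := fun w => ⟨w.1.1 + g w.2.1, by
        have h : f w.1.1 = 0 := w.1.2
        simpa [hg', h] using w.2.2⟩
      left_inv := fun v => by simp
      right_inv := fun w => by
        have h : f w.1.1 = 0 := w.1.2
        ext <;> simp [hg', h] }

theorem cast_card_linearIndependent {K V : Type*} [Field K] [Fintype K] [AddCommGroup V]
    [Module K V] [Finite V] {k : ℕ} (hk : k ≤ Module.finrank K V) :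
    (Nat.card {s : Fin k → V // LinearIndependent K s} : ℚ) =
      ∏ i ∈ Finset.range k,
        ((Fintype.card K : ℚ) ^ Module.finrank K V - (Fintype.card K : ℚ) ^ i) := by
  rw [card_linearIndependent hk, Finset.prod_range, Nat.cast_prod]
  refine Finset.prod_congr rfl fun i _ => ?_
  rw [Nat.cast_sub (Nat.pow_le_pow_right Fintype.card_pos (i.2.le.trans hk))]
  simp

theorem one_lt_cast_card (K : Type*) [Field K] [Fintype K] : (1 : ℚ) < Fintype.card K :=
  Nat.one_lt_cast.2 Fintype.one_lt_card

theorem natCard_submodule_finrank_eq {K V : Type*} [Field K] [Fintype K] [AddCommGroup V]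
    [Module K V] [Finite V] {k : ℕ} (hk : k ≤ Module.finrank K V) :
    (Nat.card {W : Submodule K V // Module.finrank K W = k} : ℚ) =
      qBinom (Fintype.card K : ℚ) (Module.finrank K V) k := by
  have hq := one_lt_cast_card K
  have hne := prod_pow_sub_pow_ne_zero hq (le_refl k)
  apply mul_right_cancel₀ hne
  rw [qBinom_mul_prod hq hk, ← cast_card_linearIndependent hk]
  have hfr : Module.finrank K (Fin k → K) = k := by simp
  have hcard := cast_card_linearIndependent (K := K) (V := Fin k → K) (k := k) (by simp)
  rw [hfr] at hcard
  rw [← hcard]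
  have := Nat.card_mul_eq_card_mul_of_rel
    (α := {s : Fin k → V // LinearIndependent K s})
    (β := {W : Submodule K V // Module.finrank K W = k})
    (fun s W => ∀ i, s.1 i ∈ W.1) 1
    (Nat.card {s : Fin k → Fin k → K // LinearIndependent K s}) ?_ ?_
  · rw [mul_one] at this
    exact_mod_cast this.symm
  · rintro ⟨s, hs⟩
    have hfin : Module.finrank K (Submodule.span K (Set.range s)) = k := by
      rw [finrank_span_eq_card hs, Fintype.card_fin]
    rw [Nat.card_eq_one_iff_exists]
    refine ⟨⟨⟨Submodule.span K (Set.range s), hfin⟩,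
      fun i => Submodule.subset_span ⟨i, rfl⟩⟩, ?_⟩
    rintro ⟨⟨W, hW⟩, h⟩
    ext1
    ext1
    exact (Submodule.eq_of_le_of_finrank_eq
      (Submodule.span_le.2 (Set.range_subset_iff.2 h)) (hfin.trans hW.symm)).symm
  · rintro ⟨W, hW⟩
    have e : W ≃ₗ[K] (Fin k → K) := LinearEquiv.ofFinrankEq _ _ (by rw [hW, hfr])
    exact Nat.card_congr
      { toFun := fun s => ⟨fun i => e ⟨s.1.1 i, s.2 i⟩, by
          refine LinearIndependent.map' (v := fun i => (⟨s.1.1 i, s.2 i⟩ : W)) ?_ e.toLinearMap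
            e.ker
          exact LinearIndependent.of_comp W.subtype s.1.2⟩
        invFun := fun t => ⟨⟨fun i => (e.symm (t.1 i) : V), by
          refine LinearIndependent.map' (v := fun i => e.symm (t.1 i)) ?_ W.subtype
            W.ker_subtype
          exact t.2.map' e.symm.toLinearMap e.symm.ker⟩, fun i => (e.symm (t.1 i)).2⟩
        left_inv := fun s => by simp
        right_inv := fun t => by simp }

theorem natCard_submodule_le_finrank_eq {K V : Type*} [Field K] [Fintype K] [AddCommGroup V]
    [Module K V] [Finite V] (S : Submodule K V) {k : ℕ} (hk : k ≤ Module.finrank K S) :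
    (Nat.card {W : Submodule K V // W ≤ S ∧ Module.finrank K W = k} : ℚ) =
      qBinom (Fintype.card K : ℚ) (Module.finrank K S) k := by
  rw [← natCard_submodule_finrank_eq hk]
  congr 1
  exact Nat.card_congr
    { toFun := fun W => ⟨W.1.comap S.subtype, by
        rw [(Submodule.comapSubtypeEquivOfLe W.2.1).finrank_eq, W.2.2]⟩
      invFun := fun W => ⟨W.1.map S.subtype, Submodule.map_subtype_le _ _, by
        rw [Submodule.finrank_map_subtype_eq, W.2]⟩
      left_inv := fun W => by
        ext1
        simpa [Submodule.map_comap_subtype] using W.2.1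
      right_inv := fun W => by
        ext1
        exact Submodule.comap_map_eq_of_injective S.injective_subtype _ }

theorem natCard_alternating (F : Type*) [Field F] [Fintype F] (l : ℕ) :
    Nat.card {M : Matrix (Fin l) (Fin l) F // (∀ i, M i i = 0) ∧ ∀ i j, M i j + M j i = 0} =
      ∏ i ∈ Finset.range l, Fintype.card F ^ i := by
  have h : Nat.card ((j : Fin l) → Fin j → F) = ∏ i ∈ Finset.range l, Fintype.card F ^ i := by
    rw [Nat.card_eq_fintype_card, Fintype.card_pi, Finset.prod_range]
    simp
  rw [← h]
  exact Nat.card_congr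
    { toFun := fun M j i => M.1 ⟨i, i.2.trans j.2⟩ j
      invFun := fun f => ⟨fun i j => if h : i < j then f j ⟨i, h⟩ else
        if h : j < i then - f i ⟨j, h⟩ else 0, by simp, by
          intro i j
          rcases lt_trichotomy i j with h | rfl | h
          · simp [h, h.not_gt]
          · simp
          · simp [h, h.not_gt]⟩
      left_inv := fun M => by
        ext i j
        rcases lt_trichotomy i j with h | rfl | h
        · simp [h]
        · simp [M.2.1]
        · simpa [h, h.not_gt] using (eq_neg_of_add_eq_zero_right (M.2.2 j i)).symm
      right_inv := fun f => by
        ext j i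
        have : (⟨i, i.2.trans j.2⟩ : Fin l) < j := i.2
        simp [this] }

end Counting

section Hyperbolic

variable {F : Type*} [Field F] {d l k : ℕ}

/-- The linear map sending a vector of `H^d` to its first coordinates. -/
def hypFst (F : Type*) [Field F] (d : ℕ) : (Fin d → F × F) →ₗ[F] Fin d → F :=
  (LinearMap.fst F F F).compLeft (Fin d)

/-- The linear map sending a vector of `H^d` to its second coordinates. -/
def hypSnd (F : Type*) [Field F] (d : ℕ) : (Fin d → F × F) →ₗ[F] Fin d → F :=
  (LinearMap.snd F F F).compLeft (Fin d)

/-- The (non-symmetric) bilinear form `(x, y), (x', y') ↦ x · y'` on `H^d`, whose associated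
quadratic form is the hyperbolic one. -/
def hypForm (v w : Fin d → F × F) : F := hypFst F d v ⬝ᵥ hypSnd F d w

theorem hypForm_self (v : Fin d → F × F) : hypForm v v = ∑ i, (v i).1 * (v i).2 := rfl

theorem hypForm_zero_left (w : Fin d → F × F) : hypForm 0 w = 0 := by simp [hypForm]

theorem hypForm_zero_right (w : Fin d → F × F) : hypForm w 0 = 0 := by simp [hypForm]

theorem hypForm_add_left (u v w : Fin d → F × F) :
    hypForm (u + v) w = hypForm u w + hypForm v w := by simp [hypForm]

theorem hypForm_add_right (u v w : Fin d → F × F) :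
    hypForm u (v + w) = hypForm u v + hypForm u w := by simp [hypForm]

theorem hypForm_smul_left (c : F) (v w : Fin d → F × F) :
    hypForm (c • v) w = c * hypForm v w := by simp [hypForm]

theorem hypForm_smul_right (c : F) (v w : Fin d → F × F) :
    hypForm v (c • w) = c * hypForm v w := by simp [hypForm]

theorem metab_eq_ker : metab F d = LinearMap.ker (hypSnd F d) := by
  ext v
  exact funext_iff.symm

theorem hypForm_eq_zero_of_mem_metab (v : Fin d → F × F) {w : Fin d → F × F}
    (hw : w ∈ metab F d) : hypForm v w = 0 := by
  rw [metab_eq_ker, LinearMap.mem_ker] at hw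
  simp [hypForm, hw]

theorem hypForm_polar_eq_zero {W : Submodule F (Fin d → F × F)}
    (hW : ∀ v ∈ W, hypForm v v = 0) {v w : Fin d → F × F} (hv : v ∈ W) (hw : w ∈ W) :
    hypForm v w + hypForm w v = 0 := by
  have h := hW _ (W.add_mem hv hw)
  simpa [hypForm_add_left, hypForm_add_right, hW v hv, hW w hw, add_comm] using h

theorem hypForm_self_eq_zero_of_mem_span {s : Set (Fin d → F × F)}
    (h1 : ∀ v ∈ s, hypForm v v = 0) (h2 : ∀ v ∈ s, ∀ w ∈ s, hypForm v w + hypForm w v = 0)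
    {v : Fin d → F × F} (hv : v ∈ Submodule.span F s) : hypForm v v = 0 := by
  have h3 : ∀ v ∈ s, ∀ w ∈ Submodule.span F s, hypForm v w + hypForm w v = 0 := by
    intro v hv w hw
    induction hw using Submodule.span_induction with
    | mem w hw => exact h2 v hv w hw
    | zero => simp [hypForm_zero_left, hypForm_zero_right]
    | add a b _ _ ha hb =>
      rw [hypForm_add_left, hypForm_add_right]
      linear_combination ha + hb
    | smul c a _ ha =>
      rw [hypForm_smul_left, hypForm_smul_right]
      linear_combination c * ha
  have h4 : ∀ v ∈ Submodule.span F s, ∀ w ∈ Submodule.span F s,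
      hypForm v w + hypForm w v = 0 := by
    intro v hv w hw
    induction hv using Submodule.span_induction with
    | mem v hv => exact h3 v hv w hw
    | zero => simp [hypForm_zero_left, hypForm_zero_right]
    | add a b _ _ ha hb =>
      rw [hypForm_add_left, hypForm_add_right]
      linear_combination ha + hb
    | smul c a _ ha =>
      rw [hypForm_smul_left, hypForm_smul_right]
      linear_combination c * ha
  induction hv using Submodule.span_induction with
  | mem w hw => exact h1 w hw
  | zero => exact hypForm_zero_left _
  | add a b hma hmb ha hb =>
    rw [hypForm_add_left, hypForm_add_right, hypForm_add_right]
    linear_combination ha + hb + h4 a hma b hmb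
  | smul c a _ ha => rw [hypForm_smul_left, hypForm_smul_right, ha, mul_zero, mul_zero]

theorem exists_dotProduct_eq {y : Fin l → Fin d → F} (hy : LinearIndependent F y)
    (b : Fin l → F) : ∃ x : Fin d → F, ∀ i, x ⬝ᵥ y i = b i := by
  have hr : (Matrix.of y).rank = l := by
    simpa using LinearIndependent.rank_matrix (M := Matrix.of y) hy
  have htop : LinearMap.range (Matrix.of y).mulVecLin = ⊤ :=
    Submodule.eq_top_of_finrank_eq (by simpa [Matrix.rank] using hr)
  obtain ⟨x, hx⟩ := LinearMap.range_eq_top.1 htop b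
  refine ⟨x, fun i => ?_⟩
  rw [← hx, dotProduct_comm]
  rfl

/-- The linear map `x ↦ (x i · y j)` sending a tuple to its matrix of dot products with `y`. -/
def dotMatrix (y : Fin l → Fin d → F) :
    (Fin l → Fin d → F) →ₗ[F] Matrix (Fin l) (Fin l) F where
  toFun x := Matrix.of fun i j => x i ⬝ᵥ y j
  map_add' a b := by ext; simp
  map_smul' c a := by ext; simp

theorem dotMatrix_surjective {y : Fin l → Fin d → F} (hy : LinearIndependent F y) :
    Function.Surjective (dotMatrix y) := by
  intro M
  choose x hx using fun i => exists_dotProduct_eq hy (M i)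
  exact ⟨x, by ext i j; exact hx i j⟩

theorem natCard_ker_of_surjective [Fintype F] {V V' : Type*} [AddCommGroup V] [Module F V]
    [AddCommGroup V'] [Module F V'] [Module.Finite F V] (f : V →ₗ[F] V')
    (hf : Function.Surjective f) {n : ℕ}
    (hn : Module.finrank F V = Module.finrank F V' + n) :
    Nat.card (LinearMap.ker f) = Fintype.card F ^ n := by
  have h := f.finrank_range_add_finrank_ker
  rw [LinearMap.range_eq_top.2 hf, finrank_top] at h
  rw [Module.natCard_eq_pow_finrank (K := F), Nat.card_eq_fintype_card]
  congr 1
  omega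

/-- A tuple in `H^d` with linearly independent second coordinates and isotropic span. -/
def IsIsotropicFrame (w : Fin l → Fin d → F × F) : Prop :=
  LinearIndependent F (hypSnd F d ∘ w) ∧
    (∀ i, hypForm (w i) (w i) = 0) ∧ ∀ i j, hypForm (w i) (w j) + hypForm (w j) (w i) = 0

theorem natCard_isIsotropicFrame [Fintype F] (hl : l ≤ d) :
    Nat.card {w : Fin l → Fin d → F × F // IsIsotropicFrame w} =
      Nat.card {y : Fin l → Fin d → F // LinearIndependent F y} *
        (Fintype.card F ^ (l * (d - l)) * ∏ i ∈ Finset.range l, Fintype.card F ^ i) := by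
  let p : Matrix (Fin l) (Fin l) F → Prop :=
    fun M => (∀ i, M i i = 0) ∧ ∀ i j, M i j + M j i = 0
  rw [← Nat.card_sigma_const (α := {y : Fin l → Fin d → F // LinearIndependent F y})
    (β := fun y => {x // p (dotMatrix y.1 x)})]
  · exact Nat.card_congr
      { toFun := fun w => ⟨⟨hypSnd F d ∘ w.1, w.2.1⟩, ⟨hypFst F d ∘ w.1, w.2.2⟩⟩
        invFun := fun a => ⟨fun i j => (a.2.1 i j, a.1.1 i j), a.1.2, a.2.2⟩
        left_inv := fun _ => rfl
        right_inv := fun _ => rfl }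
  · rintro ⟨y, hy⟩
    rw [LinearMap.natCard_preimage_of_surjective _ (dotMatrix_surjective hy), natCard_alternating,
      natCard_ker_of_surjective _ (dotMatrix_surjective hy)]
    obtain ⟨m, rfl⟩ := Nat.exists_eq_add_of_le hl
    simp [Module.finrank_matrix, Module.finrank_pi_fintype]
    ring

/-- The vectors of the metabolizer orthogonal to all members of the tuple `w` form the kernel of
this linear map. -/
def sndProdForm (w : Fin l → Fin d → F × F) :
    (Fin d → F × F) →ₗ[F] (Fin d → F) × (Fin l → F) where
  toFun v := (hypSnd F d v, fun i => hypForm v (w i))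
  map_add' u v := by ext <;> simp [hypForm_add_left]
  map_smul' c v := by ext <;> simp [hypForm_smul_left]

theorem mem_ker_sndProdForm {w : Fin l → Fin d → F × F} {v : Fin d → F × F} :
    v ∈ LinearMap.ker (sndProdForm w) ↔ v ∈ metab F d ∧ ∀ i, hypForm v (w i) = 0 := by
  rw [metab_eq_ker, LinearMap.mem_ker, LinearMap.mem_ker, ← funext_iff]
  exact Prod.ext_iff

theorem finrank_ker_sndProdForm {w : Fin l → Fin d → F × F}
    (hw : LinearIndependent F (hypSnd F d ∘ w)) :
    Module.finrank F (LinearMap.ker (sndProdForm w)) = d - l := by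
  have hsurj : Function.Surjective (sndProdForm w) := by
    rintro ⟨a, b⟩
    obtain ⟨x, hx⟩ := exists_dotProduct_eq hw b
    exact ⟨fun i => (x i, a i), Prod.ext rfl (funext hx)⟩
  have h := (sndProdForm w).finrank_range_add_finrank_ker
  rw [LinearMap.range_eq_top.2 hsurj, finrank_top] at h
  simp [Module.finrank_pi_fintype] at h
  omega

/-- `W` is an isotropic subspace of dimension `k` whose intersection with the metabolizer has
codimension `l` in `W`. -/
def IsIsotropicOfType (k l : ℕ) (W : Submodule F (Fin d → F × F)) : Prop :=
  Module.finrank F W = k ∧ (∀ v ∈ W, ∑ i, (v i).1 * (v i).2 = 0) ∧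
    Module.finrank F W - Module.finrank F ↥(W ⊓ metab F d) = l

theorem IsIsotropicOfType.finrank_inf {W : Submodule F (Fin d → F × F)}
    (hW : IsIsotropicOfType k l W) : Module.finrank F ↥(W ⊓ metab F d) + l = k := by
  have := Submodule.finrank_mono (R := F) (inf_le_left : W ⊓ metab F d ≤ W)
  have h1 := hW.1
  have h2 := hW.2.2
  omega

theorem IsIsotropicFrame.span_inf_metab {w : Fin l → Fin d → F × F} (hw : IsIsotropicFrame w) :
    Submodule.span F (Set.range w) ⊓ metab F d = ⊥ := by
  rw [metab_eq_ker]
  exact (Submodule.range_ker_disjoint hw.1).eq_bot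

theorem IsIsotropicFrame.finrank_span_sup {w : Fin l → Fin d → F × F} (hw : IsIsotropicFrame w)
    {K : Submodule F (Fin d → F × F)} (hK : K ≤ metab F d) :
    Module.finrank F ↥(Submodule.span F (Set.range w) ⊔ K) = l + Module.finrank F K := by
  have h := Submodule.finrank_sup_add_finrank_inf_eq (Submodule.span F (Set.range w)) K
  have h0 : Submodule.span F (Set.range w) ⊓ K = ⊥ :=
    le_bot_iff.1 ((inf_le_inf_left _ hK).trans hw.span_inf_metab.le)
  rw [h0, finrank_bot, add_zero, finrank_span_eq_card (LinearIndependent.of_comp _ hw.1),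
    Fintype.card_fin] at h
  exact h

theorem IsIsotropicFrame.span_sup_inf_metab {w : Fin l → Fin d → F × F}
    (hw : IsIsotropicFrame w) {K : Submodule F (Fin d → F × F)} (hK : K ≤ metab F d) :
    (Submodule.span F (Set.range w) ⊔ K) ⊓ metab F d = K := by
  rw [sup_comm, sup_inf_assoc_of_le _ hK, hw.span_inf_metab, sup_bot_eq]

theorem IsIsotropicFrame.isIsotropicOfType_span_sup {w : Fin l → Fin d → F × F}
    (hw : IsIsotropicFrame w) (hl : l ≤ k) {K : Submodule F (Fin d → F × F)}
    (hK : K ≤ LinearMap.ker (sndProdForm w)) (hKr : Module.finrank F K = k - l) :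
    IsIsotropicOfType k l (Submodule.span F (Set.range w) ⊔ K) := by
  have hKm : K ≤ metab F d := fun v hv => (mem_ker_sndProdForm.1 (hK hv)).1
  refine ⟨by rw [hw.finrank_span_sup hKm]; omega, fun v hv => ?_, ?_⟩
  · rw [← Submodule.span_eq K, ← Submodule.span_union] at hv
    refine hypForm_self_eq_zero_of_mem_span ?_ ?_ hv
    · rintro _ (⟨i, rfl⟩ | hu)
      · exact hw.2.1 i
      · exact hypForm_eq_zero_of_mem_metab _ (hKm hu)
    · rintro _ (⟨i, rfl⟩ | hu) _ (⟨j, rfl⟩ | hu')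
      · exact hw.2.2 i j
      · rw [hypForm_eq_zero_of_mem_metab _ (hKm hu'), (mem_ker_sndProdForm.1 (hK hu')).2,
          add_zero]
      · rw [hypForm_eq_zero_of_mem_metab _ (hKm hu), (mem_ker_sndProdForm.1 (hK hu)).2, add_zero]
      · rw [hypForm_eq_zero_of_mem_metab _ (hKm hu), hypForm_eq_zero_of_mem_metab _ (hKm hu'),
          add_zero]
  · rw [hw.finrank_span_sup hKm, hw.span_sup_inf_metab hKm]
    omega

theorem IsIsotropicOfType.span_sup_inf_metab_eq {W : Submodule F (Fin d → F × F)}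
    (hW : IsIsotropicOfType k l W) {w : Fin l → Fin d → F × F} (hw : IsIsotropicFrame w)
    (h : ∀ i, w i ∈ W) : Submodule.span F (Set.range w) ⊔ W ⊓ metab F d = W := by
  apply Submodule.eq_of_le_of_finrank_eq
  · exact sup_le (Submodule.span_le.2 (Set.range_subset_iff.2 h)) inf_le_left
  · rw [hw.finrank_span_sup inf_le_right, hW.1, ← hW.finrank_inf, add_comm]

theorem IsIsotropicOfType.inf_metab_le_ker {W : Submodule F (Fin d → F × F)}
    (hW : IsIsotropicOfType k l W) {w : Fin l → Fin d → F × F} (h : ∀ i, w i ∈ W) :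
    W ⊓ metab F d ≤ LinearMap.ker (sndProdForm w) := by
  rintro v ⟨hv, hvm⟩
  refine mem_ker_sndProdForm.2 ⟨hvm, fun i => ?_⟩
  have := hypForm_polar_eq_zero hW.2.1 hv (h i)
  rwa [hypForm_eq_zero_of_mem_metab _ hvm, add_zero] at this

theorem IsIsotropicFrame.natCard_isIsotropicOfType [Fintype F] {w : Fin l → Fin d → F × F}
    (hw : IsIsotropicFrame w) (hl : l ≤ k) (hk : k ≤ d) :
    (Nat.card {W : {W : Submodule F (Fin d → F × F) // IsIsotropicOfType k l W} //
        ∀ i, w i ∈ W.1} : ℚ) = qBinom (Fintype.card F : ℚ) (d - l) (k - l) := by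
  have hfr := finrank_ker_sndProdForm hw.1
  rw [← hfr, ← natCard_submodule_le_finrank_eq _ (by omega)]
  congr 1
  exact Nat.card_congr
    { toFun := fun W => ⟨W.1.1 ⊓ metab F d, W.1.2.inf_metab_le_ker W.2,
        Nat.eq_sub_of_add_eq W.1.2.finrank_inf⟩
      invFun := fun K => ⟨⟨Submodule.span F (Set.range w) ⊔ K.1,
        hw.isIsotropicOfType_span_sup hl K.2.1 K.2.2⟩,
        fun i => Submodule.mem_sup_left (Submodule.subset_span ⟨i, rfl⟩)⟩
      left_inv := fun W => Subtype.ext (Subtype.ext (W.1.2.span_sup_inf_metab_eq hw W.2))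
      right_inv := fun K => Subtype.ext (hw.span_sup_inf_metab
        fun _ hv => (mem_ker_sndProdForm.1 (K.2.1 hv)).1) }

theorem IsIsotropicOfType.natCard_isIsotropicFrame [Fintype F]
    {W : Submodule F (Fin d → F × F)} (hW : IsIsotropicOfType k l W) :
    Nat.card {w : {w : Fin l → Fin d → F × F // IsIsotropicFrame w} // ∀ i, w.1 i ∈ W} =
      Fintype.card F ^ (l * (k - l)) *
        Nat.card {y : Fin l → Fin l → F // LinearIndependent F y} := by
  let f : W →ₗ[F] Fin d → F := (hypSnd F d).domRestrict W
  have hfU : Module.finrank F (LinearMap.range f) = l := by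
    have h1 := f.finrank_range_add_finrank_ker
    have h2 : Module.finrank F (LinearMap.ker f) = Module.finrank F ↥(W ⊓ metab F d) := by
      rw [← Submodule.map_comap_subtype, Submodule.finrank_map_subtype_eq, metab_eq_ker]
      rfl
    have := hW.finrank_inf
    have := hW.1
    omega
  let e : LinearMap.range f ≃ₗ[F] (Fin l → F) := LinearEquiv.ofFinrankEq _ _ (by simp [hfU])
  let g : W →ₗ[F] Fin l → F := e.toLinearMap ∘ₗ f.rangeRestrict
  have hg : Function.Surjective (g.compLeft (Fin l)) := by
    have : Function.Surjective g := e.surjective.comp f.surjective_rangeRestrict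
    exact this.comp_left
  have hli : ∀ w : Fin l → W,
      LinearIndependent F (g.compLeft (Fin l) w) ↔ LinearIndependent F (f ∘ w) := by
    intro w
    have h1 := LinearMap.linearIndependent_iff (v := f.rangeRestrict ∘ w) e.toLinearMap e.ker
    have h2 := LinearMap.linearIndependent_iff (v := f.rangeRestrict ∘ w)
      (LinearMap.range f).subtype (Submodule.ker_subtype _)
    exact h1.trans h2.symm
  have hker : Nat.card (LinearMap.ker (g.compLeft (Fin l))) = Fintype.card F ^ (l * (k - l)) := by
    refine natCard_ker_of_surjective _ hg ?_
    rw [Module.finrank_pi_fintype, Module.finrank_pi_fintype, hW.1, ← hW.finrank_inf]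
    simp
    ring
  rw [← hker, ← LinearMap.natCard_preimage_of_surjective _ hg]
  exact Nat.card_congr
    { toFun := fun w => ⟨fun i => ⟨w.1.1 i, w.2 i⟩, (hli _).2 w.1.2.1⟩
      invFun := fun w => ⟨⟨fun i => (w.1 i : Fin d → F × F), (hli _).1 w.2,
        fun i => hW.2.1 _ (w.1 i).2,
        fun i j => hypForm_polar_eq_zero hW.2.1 (w.1 i).2 (w.1 j).2⟩, fun i => (w.1 i).2⟩
      left_inv := fun _ => rfl
      right_inv := fun _ => rfl }

end Hyperbolic

/-- In the split quadratic space `H^d` (orthogonal sum of `d` hyperbolic planes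
`(x,y) ↦ xy`) over a finite field of odd cardinality `q`, the number of
`k`-dimensional isotropic subspaces `W` with `dim(W/(W ∩ I)) = l` equals
`q^{l(2d+l-2k-1)/2} C(d,k)_q C(k,l)_q`. -/
theorem stmt17 (F : Type*) [Field F] [Fintype F] (q : ℕ)
    (hq : Fintype.card F = q) (hodd : Odd q)
    (d k l : ℕ) (hl : l ≤ k) (hk : k ≤ d) :
    (Nat.card {W : Submodule F (Fin d → F × F) //
        Module.finrank F W = k ∧
        (∀ v ∈ W, ∑ i, (v i).1 * (v i).2 = 0) ∧
        Module.finrank F W - Module.finrank F ↥(W ⊓ metab F d) = l} : ℚ) =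
      (q : ℚ) ^ (l * (2 * d + l - 2 * k - 1) / 2) *
        qBinom (q : ℚ) d k * qBinom (q : ℚ) k l := by
  subst hq
  have hq := one_lt_cast_card F
  set q : ℚ := (Fintype.card F : ℚ) with hqdef
  have hq0 : q ≠ 0 := by positivity
  set N := Nat.card {W : Submodule F (Fin d → F × F) // IsIsotropicOfType k l W}
  change (N : ℚ) = _
  have hcount : Nat.card {w : Fin l → Fin d → F × F // IsIsotropicFrame w} *
      Nat.card {K : Submodule F (Fin (d - l) → F) // Module.finrank F K = k - l} =
      N * (Fintype.card F ^ (l * (k - l)) *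
        Nat.card {y : Fin l → Fin l → F // LinearIndependent F y}) := by
    refine Nat.card_mul_eq_card_mul_of_rel (fun w W => ∀ i, w.1 i ∈ W.1) _ _ ?_ ?_
    · intro w
      have h1 := w.2.natCard_isIsotropicOfType hl hk
      have h2 := natCard_submodule_finrank_eq (K := F) (V := Fin (d - l) → F) (k := k - l)
        (by simp; omega)
      rw [Module.finrank_fin_fun] at h2
      exact_mod_cast h1.trans h2.symm
    · exact fun W => W.2.natCard_isIsotropicFrame
  rw [natCard_isIsotropicFrame (hl.trans hk)] at hcount
  have hcast := congrArg (Nat.cast : ℕ → ℚ) hcount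
  have hd := cast_card_linearIndependent (K := F) (V := Fin d → F) (k := l)
    (by simpa using hl.trans hk)
  have hll := cast_card_linearIndependent (K := F) (V := Fin l → F) (k := l) (by simp)
  have hK := natCard_submodule_finrank_eq (K := F) (V := Fin (d - l) → F) (k := k - l)
    (by simp; omega)
  rw [Module.finrank_fin_fun] at hd hll hK
  push_cast at hcast
  rw [hd, hll, hK, ← hqdef, ← qBinom_mul_prod hq (hl.trans hk)] at hcast
  have hP := prod_pow_sub_pow_ne_zero hq (le_refl l)
  apply mul_right_cancel₀ hP
  apply mul_right_cancel₀ (pow_ne_zero (l * (k - l)) hq0)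
  have htri := qBinom_trinomial hq hl hk
  have hexp : q ^ (l * (2 * d + l - 2 * k - 1) / 2) * q ^ (l * (k - l)) =
      q ^ (l * (d - l)) * ∏ i ∈ Finset.range l, q ^ i := by
    rw [Finset.prod_pow_eq_pow_sum, Finset.sum_range_id, ← pow_add, ← pow_add]
    congr 1
    obtain ⟨a, rfl⟩ := Nat.exists_eq_add_of_le hl
    obtain ⟨b, rfl⟩ := Nat.exists_eq_add_of_le hk
    rcases l with _ | l
    · simp
    · rw [show 2 * (l + 1 + a + b) + (l + 1) - 2 * (l + 1 + a) - 1 = 2 * b + l by omega,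
        show l + 1 + a + b - (l + 1) = a + b by omega, show l + 1 + a - (l + 1) = a by omega,
        show (l + 1) * (2 * b + l) = (l + 1) * l + 2 * ((l + 1) * b) by ring,
        Nat.add_mul_div_left _ _ (by norm_num), Nat.add_sub_cancel]
      ring
  linear_combination -hcast +
    (q ^ (l * (d - l)) * (∏ i ∈ Finset.range l, q ^ i) *
      ∏ i ∈ Finset.range l, (q ^ l - q ^ i)) * htri -
    (qBinom q d k * qBinom q k l * ∏ i ∈ Finset.range l, (q ^ l - q ^ i)) * hexp
end

section
/- For every permutation λ ∈ S_d and every finite field F_q, the set of canonical bases of F_q^d with length-permutation λ has cardinality q^{inv(λ)}, where inv(λ) is the number of inversions of λ. Concretely: the set of tuples (f_1,…,f_d) of vectors in F_q^d such that for each i, f_i has coordinate 1 at position λ(i), coordinate 0 at positions λ(1),…,λ(i-1) and at all positions greater than λ(i), and arbitrary coordinates elsewhere, has cardinality q^{inv(λ)}. -/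
/-- Number of inversions of a permutation of `Fin d`. -/
def invPerm {d : ℕ} (σ : Equiv.Perm (Fin d)) : ℕ :=
  (Finset.univ.filter (fun p : Fin d × Fin d => p.1 < p.2 ∧ σ p.2 < σ p.1)).card

/-- A canonical basis is determined by its free entries, which lie at the positions
`(i, lam j)` for the inversions `(i, j)` of `lam`. -/
def canonicalBasisEquiv (F : Type*) [Zero F] [One F] {d : ℕ} (lam : Equiv.Perm (Fin d)) :
    {f : Fin d → Fin d → F //
        ∀ i : Fin d, f i (lam i) = 1 ∧
          (∀ j : Fin d, j < i → f i (lam j) = 0) ∧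
          (∀ m : Fin d, lam i < m → f i m = 0)} ≃
      ({p : Fin d × Fin d // p.1 < p.2 ∧ lam p.2 < lam p.1} → F) where
  toFun f p := f.1 p.1.1 (lam p.1.2)
  invFun g := ⟨fun i m =>
    if h : i < lam.symm m ∧ m < lam i then g ⟨(i, lam.symm m), by simpa using h⟩
    else if m = lam i then 1 else 0, fun i => by
      refine ⟨by simp, fun j hj => ?_, fun m hm => ?_⟩
      · simp [hj.not_gt, hj.ne]
      · simp [hm.not_gt, hm.ne']⟩
  left_inv f := by
    obtain ⟨f, hf⟩ := f
    ext i m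
    obtain ⟨j, rfl⟩ := lam.surjective m
    obtain ⟨h1, h2, h3⟩ := hf i
    by_cases h : i < j ∧ lam j < lam i
    · simp [h]
    · rcases lt_trichotomy j i with hj | rfl | hj
      · simp [hj.not_gt, hj.ne, h2 j hj]
      · simp [h1]
      · have hm : lam i < lam j :=
          lt_of_le_of_ne (not_lt.1 fun h' => h ⟨hj, h'⟩) (lam.injective.ne hj.ne)
        simp [hm.not_gt, hj.ne', h3 _ hm]
  right_inv g := by
    ext ⟨⟨i, j⟩, hp⟩
    simp only [] at hp
    simp [hp]

/-- The set of canonical bases of `F_q^d` with length-permutation `λ`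
has cardinality `q^{inv(λ)}`: a canonical basis is a tuple `(f_1, …, f_d)`
where `f_i` has coordinate `1` at position `λ(i)`, coordinate `0` at the
positions `λ(1), …, λ(i-1)` and at all positions greater than `λ(i)`, and
arbitrary coordinates elsewhere. -/
theorem stmt18 (F : Type*) [Field F] [Fintype F] (q : ℕ)
    (hq : Fintype.card F = q) (d : ℕ) (lam : Equiv.Perm (Fin d)) :
    Nat.card {f : Fin d → Fin d → F //
        ∀ i : Fin d, f i (lam i) = 1 ∧
          (∀ j : Fin d, j < i → f i (lam j) = 0) ∧
          (∀ m : Fin d, lam i < m → f i m = 0)} =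
      q ^ invPerm lam := by
  rw [Nat.card_congr (canonicalBasisEquiv F lam), Nat.card_fun, Nat.card_eq_fintype_card, hq,
    Nat.card_eq_fintype_card, Fintype.card_subtype, invPerm]
end
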